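/- arXiv:1004.5482 — 2 statements merged into one kernel-verified Lean document; each statement's English description precedes it below -/
import Mathlib

section
/- Fix u₀ ∈ 𝒞. Define the domain D_{u₀} := {0} ∪ { v ∈ T_{u₀}𝒞 : v ≠ 0 and ‖v‖_{u₀} < arccot( −(min_M v)/(2‖v‖_{u₀}) ) }, where arccot is valued in (0,π), and define the exponential map exp_{u₀} : D_{u₀} → 𝒞 by exp_{u₀}(0) := u₀ and, for v ≠ 0, exp_{u₀}(v) := u₀ + 2 log( cos(‖v‖_{u₀}) + (v/(2‖v‖_{u₀})) sin(‖v‖_{u₀}) ). Then exp_{u₀} is well defined (its values lie in 𝒞) and is both injective and surjective onto 𝒞. -/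
open MeasureTheory Real
open scoped Classical

/-- The inverse cotangent, valued in `(0, π)`. -/
noncomputable def arccot (x : ℝ) : ℝ := Real.pi / 2 - Real.arctan x

/-- The Calabi norm `‖v‖_{u₀} = (∫ v² e^{u₀} dμ)^{1/2}`. -/
noncomputable def calabiNorm {M : Type*} [MeasurableSpace M] (μ : Measure M)
    (u₀ v : M → ℝ) : ℝ :=
  Real.sqrt (∫ p, (v p) ^ 2 * Real.exp (u₀ p) ∂μ)

/-- The exponential map of the Calabi metric at `u₀`. -/
noncomputable def calabiExp {M : Type*} [MeasurableSpace M] (μ : Measure M)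
    (u₀ v : M → ℝ) : M → ℝ :=
  if v = 0 then u₀ else
    fun p => u₀ p + 2 * Real.log (Real.cos (calabiNorm μ u₀ v)
      + v p / (2 * calabiNorm μ u₀ v) * Real.sin (calabiNorm μ u₀ v))

/-- The domain `D_{u₀}` of the exponential map of the Calabi metric at `u₀`:
tangent vectors `v` which are `0` or satisfy `‖v‖_{u₀} < arccot(−(min v)/(2‖v‖_{u₀}))`. -/
def calabiExpDomain {M : Type*} [TopologicalSpace M] [MeasurableSpace M] (μ : Measure M)
    (u₀ : M → ℝ) : Set (M → ℝ) :=
  {v | Continuous v ∧ (∫ p, v p * Real.exp (u₀ p) ∂μ) = 0 ∧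
    (v = 0 ∨ calabiNorm μ u₀ v < arccot (-(⨅ p, v p) / (2 * calabiNorm μ u₀ v)))}

theorem lt_arccot_iff {a x : ℝ} (ha₀ : 0 < a) (haπ : a < π) :
    a < arccot x ↔ x * sin a < cos a := by
  have hs : 0 < sin a := sin_pos_of_pos_of_lt_pi ha₀ haπ
  have h : arctan (cos a / sin a) = π / 2 - a := by
    rw [← cot_eq_cos_div_sin, ← tan_inv_eq_cot, ← tan_pi_div_two_sub]
    exact arctan_tan (by linarith) (by linarith)
  rw [← lt_div_iff₀ hs, ← arctan_strictMono.lt_iff_lt (b := cos a / sin a), h, arccot]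
  constructor <;> intro _ <;> linarith

theorem arccot_lt_pi (x : ℝ) : arccot x < π := by
  have := neg_pi_div_two_lt_arctan x
  rw [arccot]
  linarith

theorem integrable_of_continuous_of_compactSpace {M : Type*} [TopologicalSpace M]
    [CompactSpace M] [MeasurableSpace M] [BorelSpace M] (μ : Measure M) [IsFiniteMeasure μ]
    {f : M → ℝ} (hf : Continuous f) : Integrable f μ :=
  hf.integrable_of_hasCompactSupport (HasCompactSupport.of_compactSpace f)

theorem calabiNorm_sq {M : Type*} [MeasurableSpace M] (μ : Measure M) (u₀ v : M → ℝ) :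
    calabiNorm μ u₀ v ^ 2 = ∫ p, v p ^ 2 * exp (u₀ p) ∂μ :=
  sq_sqrt (integral_nonneg fun _ => by positivity)

theorem calabiExp_zero {M : Type*} [MeasurableSpace M] (μ : Measure M) (u₀ : M → ℝ) : calabiExp μ u₀ 0 = u₀ := by
  simp [calabiExp]

theorem exists_eq_iInf {M : Type*} [TopologicalSpace M] [CompactSpace M] [Nonempty M]
    {v : M → ℝ} (hv : Continuous v) :
    ∃ q, v q = ⨅ p, v p ∧ ∀ p, v q ≤ v p := by
  obtain ⟨q, hq⟩ := hv.exists_forall_le_of_hasCompactSupport (HasCompactSupport.of_compactSpace v)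
  exact ⟨q, le_antisymm (le_ciInf hq) (ciInf_le ⟨v q, by rintro _ ⟨p, rfl⟩; exact hq p⟩ q), hq⟩

/-- The defining inequality of the domain says that the argument of the logarithm in the
exponential map is positive. -/
theorem lt_arccot_iInf_iff {M : Type*} [TopologicalSpace M] [CompactSpace M] [Nonempty M]
    {v : M → ℝ} (hv : Continuous v) {a : ℝ} (ha₀ : 0 < a) (haπ : a < π) :
    a < arccot (-(⨅ p, v p) / (2 * a)) ↔ ∀ p, 0 < cos a + v p / (2 * a) * sin a := by
  obtain ⟨q, hq, hle⟩ := exists_eq_iInf hv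
  have hs : 0 < sin a := sin_pos_of_pos_of_lt_pi ha₀ haπ
  rw [lt_arccot_iff ha₀ haπ, ← hq]
  constructor
  · intro h p
    have h₁ : v q / (2 * a) * sin a ≤ v p / (2 * a) * sin a := by
      have := hle p
      gcongr
    rw [neg_div] at h
    linarith
  · intro h
    have := h q
    rw [neg_div]
    linarith

section

variable {M : Type*} [TopologicalSpace M] [CompactSpace M] [MeasurableSpace M] [BorelSpace M]
  {μ : Measure M} [IsFiniteMeasure μ] {u₀ v : M → ℝ}

theorem eq_zero_of_integral_sq_mul_exp_eq_zero [μ.IsOpenPosMeasure] (hu₀ : Continuous u₀)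
    (hv : Continuous v) (h : ∫ p, v p ^ 2 * exp (u₀ p) ∂μ = 0) : v = 0 := by
  have hc : Continuous fun p => v p ^ 2 * exp (u₀ p) := by fun_prop
  rw [integral_eq_zero_iff_of_nonneg (fun _ => by positivity)
    (integrable_of_continuous_of_compactSpace μ hc)] at h
  have h' := (hc.ae_eq_iff_eq μ continuous_zero).1 h
  funext p
  have hp := congrFun h' p
  simpa [(exp_pos (u₀ p)).ne'] using hp

theorem calabiNorm_pos [μ.IsOpenPosMeasure] (hu₀ : Continuous u₀) (hv : Continuous v)
    (hv₀ : v ≠ 0) : 0 < calabiNorm μ u₀ v := by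
  refine lt_of_le_of_ne (sqrt_nonneg _) fun h => hv₀ ?_
  apply eq_zero_of_integral_sq_mul_exp_eq_zero (μ := μ) hu₀ hv
  rw [← calabiNorm_sq, ← h]
  simp

theorem integral_add_mul_mul_exp (hu₀ : Continuous u₀) (hv : Continuous v)
    (hV : ∫ p, exp (u₀ p) ∂μ = 1 / 4) (x y : ℝ) :
    ∫ p, (x + y * v p) * exp (u₀ p) ∂μ = x / 4 + y * ∫ p, v p * exp (u₀ p) ∂μ := by
  have h : ∀ p, (x + y * v p) * exp (u₀ p) = x * exp (u₀ p) + y * (v p * exp (u₀ p)) :=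
    fun p => by ring
  simp_rw [h]
  rw [integral_add, integral_const_mul, integral_const_mul, hV]
  · ring
  all_goals exact integrable_of_continuous_of_compactSpace μ (by fun_prop)

theorem integral_add_mul_sq_mul_exp (hu₀ : Continuous u₀) (hv : Continuous v)
    (hV : ∫ p, exp (u₀ p) ∂μ = 1 / 4) (x y : ℝ) :
    ∫ p, (x + y * v p) ^ 2 * exp (u₀ p) ∂μ =
      x ^ 2 / 4 + 2 * x * y * (∫ p, v p * exp (u₀ p) ∂μ)
        + y ^ 2 * ∫ p, v p ^ 2 * exp (u₀ p) ∂μ := by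
  have h : ∀ p, (x + y * v p) ^ 2 * exp (u₀ p) = x ^ 2 * exp (u₀ p)
      + 2 * x * y * (v p * exp (u₀ p)) + y ^ 2 * (v p ^ 2 * exp (u₀ p)) :=
    fun p => by ring
  simp_rw [h]
  rw [integral_add, integral_add, integral_const_mul, integral_const_mul, integral_const_mul, hV]
  · ring
  all_goals exact integrable_of_continuous_of_compactSpace μ (by fun_prop)

/-- A nonzero vector in the domain has norm in `(0, π)` and its exponential is
`u₀ + 2 log w` with `w` positive. -/
theorem calabiExpDomain_pos [Nonempty M] [μ.IsOpenPosMeasure] (hu₀ : Continuous u₀)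
    (hv : v ∈ calabiExpDomain μ u₀) (hv₀ : v ≠ 0) :
    0 < calabiNorm μ u₀ v ∧ calabiNorm μ u₀ v < π ∧
      ∀ p, 0 < cos (calabiNorm μ u₀ v)
        + v p / (2 * calabiNorm μ u₀ v) * sin (calabiNorm μ u₀ v) := by
  obtain ⟨hc, -, h⟩ := hv
  have h := h.resolve_left hv₀
  have ha₀ := calabiNorm_pos (μ := μ) hu₀ hc hv₀
  have haπ := h.trans (arccot_lt_pi _)
  exact ⟨ha₀, haπ, (lt_arccot_iInf_iff hc ha₀ haπ).1 h⟩

theorem exp_half_calabiExp_sub [Nonempty M] [μ.IsOpenPosMeasure] (hu₀ : Continuous u₀)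
    (hv : v ∈ calabiExpDomain μ u₀) (hv₀ : v ≠ 0) (p : M) :
    exp ((calabiExp μ u₀ v p - u₀ p) / 2) = cos (calabiNorm μ u₀ v)
      + sin (calabiNorm μ u₀ v) / (2 * calabiNorm μ u₀ v) * v p := by
  obtain ⟨-, -, h⟩ := calabiExpDomain_pos hu₀ hv hv₀
  rw [calabiExp, if_neg hv₀, add_sub_cancel_left, mul_div_cancel_left₀ _ two_ne_zero,
    exp_log (h p)]
  ring

theorem continuous_calabiExp [Nonempty M] [μ.IsOpenPosMeasure] (hu₀ : Continuous u₀)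
    (hv : v ∈ calabiExpDomain μ u₀) : Continuous (calabiExp μ u₀ v) := by
  by_cases hv₀ : v = 0
  · rwa [hv₀, calabiExp_zero]
  obtain ⟨-, -, h⟩ := calabiExpDomain_pos hu₀ hv hv₀
  have hc := hv.1
  rw [calabiExp, if_neg hv₀]
  exact hu₀.add (continuous_const.mul (Continuous.log (by fun_prop) fun p => (h p).ne'))

theorem integral_exp_calabiExp [Nonempty M] [μ.IsOpenPosMeasure] (hu₀ : Continuous u₀)
    (hV : ∫ p, exp (u₀ p) ∂μ = 1 / 4) (hv : v ∈ calabiExpDomain μ u₀) :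
    ∫ p, exp (calabiExp μ u₀ v p) ∂μ = 1 / 4 := by
  by_cases hv₀ : v = 0
  · rwa [hv₀, calabiExp_zero]
  obtain ⟨ha₀, -, -⟩ := calabiExpDomain_pos hu₀ hv hv₀
  have h : ∀ p, exp (calabiExp μ u₀ v p) = (cos (calabiNorm μ u₀ v)
      + sin (calabiNorm μ u₀ v) / (2 * calabiNorm μ u₀ v) * v p) ^ 2 * exp (u₀ p) := fun p => by
    rw [← exp_half_calabiExp_sub hu₀ hv hv₀, ← exp_nat_mul, ← exp_add]
    congr 1
    push_cast
    ring
  simp_rw [h]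
  rw [integral_add_mul_sq_mul_exp hu₀ hv.1 hV, hv.2.1, ← calabiNorm_sq]
  field_simp
  linear_combination 4 * calabiNorm μ u₀ v * cos_sq_add_sin_sq (calabiNorm μ u₀ v)

theorem integral_exp_half_calabiExp_sub [Nonempty M] [μ.IsOpenPosMeasure] (hu₀ : Continuous u₀)
    (hV : ∫ p, exp (u₀ p) ∂μ = 1 / 4) (hv : v ∈ calabiExpDomain μ u₀) :
    ∫ p, exp ((calabiExp μ u₀ v p - u₀ p) / 2) * exp (u₀ p) ∂μ
      = cos (calabiNorm μ u₀ v) / 4 := by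
  by_cases hv₀ : v = 0
  · simp [hv₀, calabiExp_zero, calabiNorm, hV]
  simp_rw [exp_half_calabiExp_sub hu₀ hv hv₀]
  rw [integral_add_mul_mul_exp hu₀ hv.1 hV, hv.2.1, mul_zero, add_zero]

theorem injOn_calabiExp [Nonempty M] [μ.IsOpenPosMeasure] (hu₀ : Continuous u₀)
    (hV : ∫ p, exp (u₀ p) ∂μ = 1 / 4) :
    Set.InjOn (calabiExp μ u₀) (calabiExpDomain μ u₀) := by
  have hmem : ∀ v ∈ calabiExpDomain μ u₀, calabiNorm μ u₀ v ∈ Set.Icc 0 π := fun v hv => by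
    by_cases hv₀ : v = 0
    · simp [hv₀, calabiNorm, pi_pos.le]
    · obtain ⟨h₀, hπ, -⟩ := calabiExpDomain_pos hu₀ hv hv₀
      exact ⟨h₀.le, hπ.le⟩
  intro v hv v' hv' h
  have hcos : cos (calabiNorm μ u₀ v) = cos (calabiNorm μ u₀ v') := by
    have h₁ := integral_exp_half_calabiExp_sub hu₀ hV hv
    rw [h, integral_exp_half_calabiExp_sub hu₀ hV hv'] at h₁
    linarith
  have hnorm := injOn_cos (hmem v hv) (hmem v' hv') hcos
  have hzero : calabiNorm μ u₀ 0 = 0 := by simp [calabiNorm]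
  by_cases hv₀ : v = 0
  · by_contra hne
    have := (calabiExpDomain_pos hu₀ hv' fun h₀ => hne (hv₀.trans h₀.symm)).1
    rw [← hnorm, hv₀, hzero] at this
    exact this.false
  obtain ⟨ha₀, haπ, -⟩ := calabiExpDomain_pos hu₀ hv hv₀
  have hv'₀ : v' ≠ 0 := by
    rintro rfl
    rw [hnorm, hzero] at ha₀
    exact ha₀.false
  funext p
  have h₁ := exp_half_calabiExp_sub hu₀ hv hv₀ p
  rw [h, exp_half_calabiExp_sub hu₀ hv' hv'₀, ← hnorm] at h₁
  have hs := sin_pos_of_pos_of_lt_pi ha₀ haπ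
  exact (mul_left_cancel₀ (by positivity) (add_left_cancel h₁)).symm

theorem exists_calabiExp_eq [Nonempty M] [μ.IsOpenPosMeasure] (hu₀ : Continuous u₀)
    (hV : ∫ p, exp (u₀ p) ∂μ = 1 / 4) {u₁ : M → ℝ} (hu₁ : Continuous u₁)
    (hV₁ : ∫ p, exp (u₁ p) ∂μ = 1 / 4) :
    ∃ v ∈ calabiExpDomain μ u₀, calabiExp μ u₀ v = u₁ := by
  by_cases hne : u₁ = u₀
  · exact ⟨0, ⟨continuous_zero, by simp, Or.inl rfl⟩, by rw [calabiExp_zero, hne]⟩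
  obtain ⟨w, hw⟩ : ∃ w : M → ℝ, w = fun p => exp ((u₁ p - u₀ p) / 2) := ⟨_, rfl⟩
  have hwc : Continuous w := by rw [hw]; fun_prop
  have hwpos : ∀ p, 0 < w p := fun p => by rw [hw]; positivity
  have hwlog : ∀ p, u₀ p + 2 * log (w p) = u₁ p := fun p => by rw [hw, log_exp]; ring
  have hw₂ : ∫ p, w p ^ 2 * exp (u₀ p) ∂μ = 1 / 4 := by
    rw [← hV₁]
    congr 1 with p
    rw [hw, ← exp_nat_mul, ← exp_add]
    congr 1
    push_cast
    ring
  obtain ⟨c, hc⟩ : ∃ c, c = 4 * ∫ p, w p * exp (u₀ p) ∂μ := ⟨_, rfl⟩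
  have hc₁ : ∫ p, w p * exp (u₀ p) ∂μ = c / 4 := by rw [hc]; ring
  have hc₀ : 0 ≤ c := by
    rw [hc]
    exact mul_nonneg (by norm_num)
      (integral_nonneg fun p => mul_nonneg (hwpos p).le (exp_pos _).le)
  have hvar : ∫ p, (-c + 1 * w p) ^ 2 * exp (u₀ p) ∂μ = (1 - c ^ 2) / 4 := by
    rw [integral_add_mul_sq_mul_exp hu₀ hwc hV, hw₂, hc₁]
    ring
  have hc_lt : c < 1 := by
    have h₀ : 0 ≤ (1 - c ^ 2) / 4 := hvar ▸ integral_nonneg fun p => by positivity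
    refine lt_of_le_of_ne (by nlinarith) fun h => hne ?_
    have hz : (fun p => -c + 1 * w p) = 0 :=
      eq_zero_of_integral_sq_mul_exp_eq_zero (μ := μ) hu₀ (by fun_prop)
        (by rw [hvar, h]; norm_num)
    funext p
    have hp : -c + 1 * w p = 0 := congrFun hz p
    have hp₁ : w p = 1 := by linarith
    rw [← hwlog p, hp₁]
    simp
  obtain ⟨a, ha⟩ : ∃ a, a = arccos c := ⟨_, rfl⟩
  have ha₀ : 0 < a := ha ▸ arccos_pos.2 hc_lt
  have hcos : cos a = c := ha ▸ cos_arccos (by linarith) hc_lt.le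
  have haπ : a < π := by
    have := arccos_le_pi_div_two.2 hc₀
    rw [ha]
    linarith [pi_pos]
  have hs : 0 < sin a := sin_pos_of_pos_of_lt_pi ha₀ haπ
  obtain ⟨v, hv⟩ : ∃ v : M → ℝ, v = fun p => 2 * a / sin a * (-c + 1 * w p) := ⟨_, rfl⟩
  have hvc : Continuous v := by rw [hv]; fun_prop
  have hvw : ∀ p, cos a + v p / (2 * a) * sin a = w p := fun p => by
    rw [hv, hcos]
    field_simp
    ring
  have hvint : ∫ p, v p * exp (u₀ p) ∂μ = 0 := by
    simp_rw [hv, mul_assoc (2 * a / sin a)]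
    rw [integral_const_mul, integral_add_mul_mul_exp hu₀ hwc hV, hc₁]
    ring
  have hnorm : calabiNorm μ u₀ v = a := by
    rw [calabiNorm, ← sqrt_sq ha₀.le]
    congr 1
    simp_rw [hv, mul_pow (2 * a / sin a), mul_assoc ((2 * a / sin a) ^ 2)]
    rw [integral_const_mul, hvar, ← hcos, ← sin_sq]
    field_simp
    norm_num
  have hv₀ : v ≠ 0 := by
    rintro rfl
    simp [calabiNorm] at hnorm
    exact ha₀.ne hnorm
  refine ⟨v, ⟨hvc, hvint, Or.inr ?_⟩, ?_⟩
  · rw [hnorm, lt_arccot_iInf_iff hvc ha₀ haπ]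
    exact fun p => (hvw p).symm ▸ hwpos p
  · rw [calabiExp, if_neg hv₀, hnorm]
    funext p
    rw [hvw, hwlog]

end

/-- The exponential map `exp_{u₀} : D_{u₀} → 𝒞` is well defined,
injective and surjective onto 𝒞. -/
theorem calabi_exp_injective_surjective
    {M : Type*} [TopologicalSpace M] [CompactSpace M] [Nonempty M]
    [MeasurableSpace M] [BorelSpace M]
    (μ : Measure M) [IsFiniteMeasure μ] [μ.IsOpenPosMeasure]
    (hVol : (μ Set.univ).toReal = 1 / 4)
    (u₀ : M → ℝ) (hu₀c : Continuous u₀) (hu₀C : ∫ p, Real.exp (u₀ p) ∂μ = 1 / 4) :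
    -- well defined: values lie in 𝒞
    (∀ v ∈ calabiExpDomain μ u₀, Continuous (calabiExp μ u₀ v) ∧
      ∫ p, Real.exp (calabiExp μ u₀ v p) ∂μ = 1 / 4) ∧
    -- injective
    Set.InjOn (calabiExp μ u₀) (calabiExpDomain μ u₀) ∧
    -- surjective onto 𝒞
    (∀ u₁ : M → ℝ, Continuous u₁ → (∫ p, Real.exp (u₁ p) ∂μ) = 1 / 4 →
      ∃ v ∈ calabiExpDomain μ u₀, calabiExp μ u₀ v = u₁) := by
  exact ⟨fun v hv => ⟨continuous_calabiExp hu₀c hv, integral_exp_calabiExp hu₀c hu₀C hv⟩,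
    injOn_calabiExp hu₀c hu₀C, fun _ hu₁ hV₁ => exists_calabiExp_eq hu₀c hu₀C hu₁ hV₁⟩
end

section
/- Let b ∈ 𝒞 be a base point and let φ : [0,1] → 𝒞 be a smooth curve. Then for every s ∈ [0,1] the geodesic distance from b to φ(s) is at most the geodesic distance from b to φ(0) plus the length of φ between φ(0) and φ(s): d(b, φ(s)) ≤ d(b, φ(0)) + ∫₀^s ( ∫_M (∂_τ φ(τ))² e^{φ(τ)} dμ )^{1/2} dτ. -/
open MeasureTheory Real

/-- A smooth family of real functions on `M` parametrized by a normed space `E`. -/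
def SmoothFamily {E M : Type*} [NormedAddCommGroup E] [NormedSpace ℝ E] [TopologicalSpace M]
    (f : E → M → ℝ) : Prop :=
  (∀ p, ContDiff ℝ (⊤ : ℕ∞) fun z => f z p) ∧
    ∀ n : ℕ, Continuous fun q : E × M => iteratedFDeriv ℝ n (fun z => f z q.2) q.1

open Filter Topology

section

variable {M : Type*} [TopologicalSpace M]

theorem SmoothFamily.continuous {φ : ℝ → M → ℝ} (hφ : SmoothFamily φ) :
    Continuous fun q : ℝ × M => φ q.1 q.2 := by
  have h := (continuous_eval_const (F := ContinuousMultilinearMap ℝ (fun _ : Fin 0 => ℝ) ℝ)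
    (fun _ : Fin 0 => (1 : ℝ))).comp (hφ.2 0)
  simpa [Function.comp_def] using h

theorem SmoothFamily.hasDerivAt {φ : ℝ → M → ℝ} (hφ : SmoothFamily φ) (τ : ℝ) (p : M) :
    HasDerivAt (fun r => φ r p) (deriv (fun r => φ r p) τ) τ :=
  ((hφ.1 p).differentiable (by simp) τ).hasDerivAt

theorem SmoothFamily.continuous_deriv {φ : ℝ → M → ℝ} (hφ : SmoothFamily φ) :
    Continuous fun q : ℝ × M => deriv (fun r => φ r q.2) q.1 := by
  have h := (continuous_eval_const (F := ContinuousMultilinearMap ℝ (fun _ : Fin 1 => ℝ) ℝ)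
    (fun _ : Fin 1 => (1 : ℝ))).comp (hφ.2 1)
  simpa [Function.comp_def] using h

variable [CompactSpace M]

/-- A jointly continuous function is bounded on a unit neighbourhood of a fibre. -/
theorem exists_bound_closedBall_of_continuous {F : ℝ → M → ℝ}
    (hF : Continuous fun q : ℝ × M => F q.1 q.2) (τ : ℝ) :
    ∃ C, ∀ r ∈ Metric.closedBall τ 1, ∀ p, ‖F r p‖ ≤ C := by
  obtain ⟨C, hC⟩ := ((isCompact_closedBall τ 1).prod
    (isCompact_univ (X := M))).exists_bound_of_continuousOn hF.continuousOn
  exact ⟨C, fun r hr p => hC (r, p) ⟨hr, Set.mem_univ p⟩⟩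

variable [MeasurableSpace M] [BorelSpace M] (μ : Measure M) [IsFiniteMeasure μ]

theorem Continuous.integrable_of_compactSpace {f : M → ℝ} (hf : Continuous f) :
    Integrable f μ := by
  obtain ⟨C, hC⟩ := isCompact_univ.exists_bound_of_continuousOn hf.continuousOn
  exact Integrable.of_bound hf.measurable.aestronglyMeasurable C
    (ae_of_all _ fun p => hC p (Set.mem_univ p))

theorem continuous_integral_of_jointly_continuous {F : ℝ → M → ℝ}
    (hF : Continuous fun q : ℝ × M => F q.1 q.2) : Continuous fun τ => ∫ p, F τ p ∂μ := by
  refine continuous_iff_continuousAt.2 fun τ => ?_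
  obtain ⟨C, hC⟩ := exists_bound_closedBall_of_continuous hF τ
  refine continuousAt_of_dominated (bound := fun _ => C) ?_ ?_ (integrable_const C) ?_
  · exact Eventually.of_forall fun r =>
      (hF.comp (Continuous.prodMk_right r)).measurable.aestronglyMeasurable
  · filter_upwards [Metric.closedBall_mem_nhds τ one_pos] with r hr
    exact ae_of_all _ (hC r hr)
  · exact ae_of_all _ fun p => (hF.comp (Continuous.prodMk_left p)).continuousAt

theorem hasDerivAt_integral_of_jointly_continuous {F F' : ℝ → M → ℝ}
    (hF : Continuous fun q : ℝ × M => F q.1 q.2) (hF' : Continuous fun q : ℝ × M => F' q.1 q.2)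
    (h : ∀ τ p, HasDerivAt (fun r => F r p) (F' τ p) τ) (τ : ℝ) :
    HasDerivAt (fun r => ∫ p, F r p ∂μ) (∫ p, F' τ p ∂μ) τ := by
  obtain ⟨C, hC⟩ := exists_bound_closedBall_of_continuous hF' τ
  refine (hasDerivAt_integral_of_dominated_loc_of_deriv_le (bound := fun _ => C)
    (Metric.closedBall_mem_nhds τ one_pos) ?_ ?_ ?_ ?_ (integrable_const C) ?_).2
  · exact Eventually.of_forall fun r =>
      (hF.comp (Continuous.prodMk_right r)).measurable.aestronglyMeasurable
  · exact (hF.comp (Continuous.prodMk_right τ)).integrable_of_compactSpace μ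
  · exact (hF'.comp (Continuous.prodMk_right τ)).measurable.aestronglyMeasurable
  · exact ae_of_all _ fun p r hr => hC r hr p
  · exact ae_of_all _ fun p r _ => h r p

theorem sq_integral_mul_le_of_continuous {f g : M → ℝ} (hf : Continuous f) (hg : Continuous g) :
    (∫ p, f p * g p ∂μ) ^ 2 ≤ (∫ p, f p ^ 2 ∂μ) * ∫ p, g p ^ 2 ∂μ := by
  have key : ∀ t : ℝ, 0 ≤ (∫ p, f p ^ 2 ∂μ) * (t * t) + (2 * ∫ p, f p * g p ∂μ) * t
      + ∫ p, g p ^ 2 ∂μ := by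
    intro t
    have h1 : Integrable (fun p => f p ^ 2 * (t * t)) μ :=
      Continuous.integrable_of_compactSpace μ (by fun_prop)
    have h2 : Integrable (fun p => 2 * (f p * g p) * t) μ :=
      Continuous.integrable_of_compactSpace μ (by fun_prop)
    have h3 : Integrable (fun p => g p ^ 2) μ :=
      Continuous.integrable_of_compactSpace μ (by fun_prop)
    rw [← integral_mul_const, ← integral_const_mul, ← integral_mul_const,
      ← integral_add h1 h2, ← integral_add (by exact h1.add h2) h3]
    exact integral_nonneg fun p => by
      have : f p ^ 2 * (t * t) + 2 * (f p * g p) * t + g p ^ 2 = (f p * t + g p) ^ 2 := by ring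
      simp only [Pi.zero_apply, this]
      positivity
  have := discrim_le_zero key
  rw [discrim] at this
  linarith

/-- The expansion of `‖B - cF‖²` for unit vectors `B = 2e^{u/2}` and `F = 2e^{v/2}` of `L²(μ)`,
with `c = ⟪B, F⟫`. -/
theorem integral_sq_exp_half_sub {u v : M → ℝ} (hu : Continuous u) (hv : Continuous v)
    (huC : ∫ p, exp (u p) ∂μ = 1 / 4) (hvC : ∫ p, exp (v p) ∂μ = 1 / 4) {c : ℝ}
    (hc : c = 4 * ∫ p, exp ((u p + v p) / 2) ∂μ) :
    ∫ p, (2 * exp (u p / 2) - c * (2 * exp (v p / 2))) ^ 2 ∂μ = 1 - c ^ 2 := by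
  have h1 : Integrable (fun p => 4 * exp (u p)) μ :=
    Continuous.integrable_of_compactSpace μ (by fun_prop)
  have h2 : Integrable (fun p => 8 * c * exp ((u p + v p) / 2)) μ :=
    Continuous.integrable_of_compactSpace μ (by fun_prop)
  have h3 : Integrable (fun p => 4 * c ^ 2 * exp (v p)) μ :=
    Continuous.integrable_of_compactSpace μ (by fun_prop)
  have e : ∀ p, (2 * exp (u p / 2) - c * (2 * exp (v p / 2))) ^ 2
      = 4 * exp (u p) - 8 * c * exp ((u p + v p) / 2) + 4 * c ^ 2 * exp (v p) := by
    intro p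
    have e1 : exp (u p) = exp (u p / 2) ^ 2 := by rw [← exp_nat_mul]; congr 1; push_cast; ring
    have e2 : exp (v p) = exp (v p / 2) ^ 2 := by rw [← exp_nat_mul]; congr 1; push_cast; ring
    rw [e1, e2, add_div, exp_add]
    ring
  simp_rw [e]
  rw [integral_add (by exact h1.sub h2) h3, integral_sub h1 h2, integral_const_mul, integral_const_mul,
    integral_const_mul, huC, hvC]
  linear_combination 2 * c * hc

/-- The Cauchy–Schwarz bound for the derivative of the affinity `⟪2e^{u/2}, 2e^{v/2}⟫` in a
direction `w` tangent to the unit sphere at `2e^{v/2}`. -/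
theorem abs_integral_mul_exp_half_le {u v w : M → ℝ} (hu : Continuous u) (hv : Continuous v)
    (hw : Continuous w) (huC : ∫ p, exp (u p) ∂μ = 1 / 4) (hvC : ∫ p, exp (v p) ∂μ = 1 / 4)
    (hwv : ∫ p, w p * exp (v p) ∂μ = 0) :
    |2 * ∫ p, w p * exp ((u p + v p) / 2) ∂μ|
      ≤ √(1 - (4 * ∫ p, exp ((u p + v p) / 2) ∂μ) ^ 2) * √(∫ p, w p ^ 2 * exp (v p) ∂μ) := by
  set c := 4 * ∫ p, exp ((u p + v p) / 2) ∂μ with hc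
  have hn := integral_sq_exp_half_sub μ hu hv huC hvC hc
  have hcs := sq_integral_mul_le_of_continuous μ
    (f := fun p => 2 * exp (u p / 2) - c * (2 * exp (v p / 2)))
    (g := fun p => w p * exp (v p / 2)) (by fun_prop) (by fun_prop)
  have e2 : ∀ p, exp (v p) = exp (v p / 2) ^ 2 := fun p => by
    rw [← exp_nat_mul]; congr 1; push_cast; ring
  have hV : ∀ p, (w p * exp (v p / 2)) ^ 2 = w p ^ 2 * exp (v p) := fun p => by
    rw [e2, mul_pow]
  have hX : ∀ p, (2 * exp (u p / 2) - c * (2 * exp (v p / 2))) * (w p * exp (v p / 2))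
      = 2 * (w p * exp ((u p + v p) / 2)) - 2 * c * (w p * exp (v p)) := fun p => by
    rw [e2, add_div, exp_add]; ring
  have h1 : Integrable (fun p => 2 * (w p * exp ((u p + v p) / 2))) μ :=
    Continuous.integrable_of_compactSpace μ (by fun_prop)
  have h2 : Integrable (fun p => 2 * c * (w p * exp (v p))) μ :=
    Continuous.integrable_of_compactSpace μ (by fun_prop)
  simp_rw [hV, hX] at hcs
  rw [hn, integral_sub h1 h2, integral_const_mul, integral_const_mul, hwv, mul_zero,
    sub_zero] at hcs
  have hpos : 0 ≤ 1 - c ^ 2 := hn ▸ integral_nonneg fun p => sq_nonneg _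
  rw [← sqrt_mul hpos]
  exact abs_le_sqrt hcs

theorem abs_affinity_le_one {u v : M → ℝ} (hu : Continuous u) (hv : Continuous v)
    (huC : ∫ p, exp (u p) ∂μ = 1 / 4) (hvC : ∫ p, exp (v p) ∂μ = 1 / 4) :
    |4 * ∫ p, exp ((u p + v p) / 2) ∂μ| ≤ 1 := by
  have hpos : 0 ≤ 1 - (4 * ∫ p, exp ((u p + v p) / 2) ∂μ) ^ 2 :=
    integral_sq_exp_half_sub μ hu hv huC hvC rfl ▸ integral_nonneg fun p => sq_nonneg _
  exact sq_le_one_iff_abs_le_one _ |>.1 (by linarith)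

end

/-- If `|g'| ≤ √(1 - g²) L` then `arccos ∘ g` grows at most at rate `L`. Contracting `g` by a
factor `k < 1` keeps it away from the points where `arccos` is not differentiable. -/
theorem arccos_le_arccos_add_integral {g g' L : ℝ → ℝ} {T : ℝ} (hL : Continuous L)
    (hL0 : ∀ τ, 0 ≤ L τ) (hg : ∀ τ, HasDerivAt g (g' τ) τ)
    (hg1 : ∀ τ ∈ Set.Icc 0 T, |g τ| ≤ 1)
    (hg' : ∀ τ ∈ Set.Ioo 0 T, |g' τ| ≤ √(1 - g τ ^ 2) * L τ) {s : ℝ} (hs : s ∈ Set.Icc 0 T) :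
    arccos (g s) ≤ arccos (g 0) + ∫ τ in (0 : ℝ)..s, L τ := by
  have hgc : Continuous g := continuous_iff_continuousAt.2 fun τ => (hg τ).continuousAt
  have contracted : ∀ k ∈ Set.Ioo (0 : ℝ) 1,
      arccos (k * g s) ≤ arccos (k * g 0) + ∫ τ in (0 : ℝ)..s, L τ := by
    rintro k ⟨hk0, hk1⟩
    have hI : ∀ τ, HasDerivAt (fun t => ∫ r in (0 : ℝ)..t, L r) (L τ) τ := fun τ =>
      intervalIntegral.integral_hasDerivAt_right (hL.intervalIntegrable _ _)
        (hL.stronglyMeasurableAtFilter _ _) hL.continuousAt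
    have hlt : ∀ τ ∈ Set.Icc 0 T, |k * g τ| < 1 := fun τ hτ => by
      rw [abs_mul, abs_of_pos hk0]
      nlinarith [hg1 τ hτ, abs_nonneg (g τ)]
    have hd : ∀ τ ∈ Set.Icc 0 T, HasDerivAt
        (fun t => (∫ r in (0 : ℝ)..t, L r) - arccos (k * g t))
        (L τ - -(1 / √(1 - (k * g τ) ^ 2)) * (k * g' τ)) τ := fun τ hτ => by
      have h := abs_lt.1 (hlt τ hτ)
      exact (hI τ).sub (HasDerivAt.comp (h₂ := arccos) (h := fun t => k * g t) τ
        (hasDerivAt_arccos h.1.ne' h.2.ne) ((hg τ).const_mul k))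
    have hmono : MonotoneOn (fun t => (∫ r in (0 : ℝ)..t, L r) - arccos (k * g t))
        (Set.Icc 0 T) := by
      refine monotoneOn_of_hasDerivWithinAt_nonneg (convex_Icc 0 T)
        (fun τ hτ => (hd τ hτ).continuousAt.continuousWithinAt)
        (fun τ hτ => (hd τ (interior_subset hτ)).hasDerivWithinAt) fun τ hτ => ?_
      have hτ' := interior_subset hτ
      rw [interior_Icc] at hτ
      have hq : 0 < √(1 - (k * g τ) ^ 2) :=
        sqrt_pos.2 (sub_pos.2 ((sq_lt_one_iff_abs_lt_one _).2 (hlt τ hτ')))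
      have hkg : k * √(1 - g τ ^ 2) ≤ √(1 - (k * g τ) ^ 2) := by
        refine le_sqrt_of_sq_le ?_
        rw [mul_pow, sq_sqrt (sub_nonneg.2 ((sq_le_one_iff_abs_le_one _).2 (hg1 τ hτ')))]
        nlinarith
      have hb : -(k * g' τ) ≤ L τ * √(1 - (k * g τ) ^ 2) := by
        calc -(k * g' τ) = k * -g' τ := by ring
          _ ≤ k * (√(1 - g τ ^ 2) * L τ) :=
            mul_le_mul_of_nonneg_left ((neg_le_abs _).trans (hg' τ hτ)) hk0.le
          _ = L τ * (k * √(1 - g τ ^ 2)) := by ring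
          _ ≤ _ := mul_le_mul_of_nonneg_left hkg (hL0 τ)
      have := (div_le_iff₀ hq).2 hb
      have e : L τ - -(1 / √(1 - (k * g τ) ^ 2)) * (k * g' τ)
          = L τ - -(k * g' τ) / √(1 - (k * g τ) ^ 2) := by ring
      rw [e]
      exact sub_nonneg.2 this
    have := hmono ⟨le_rfl, hs.1.trans hs.2⟩ hs hs.1
    simp only [intervalIntegral.integral_same] at this
    linarith
  have hlim : ∀ x : ℝ, Tendsto (fun k : ℝ => arccos (k * x)) (𝓝[<] 1) (𝓝 (arccos x)) := fun x => by
    have : Continuous fun k : ℝ => arccos (k * x) :=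
      continuous_arccos.comp (continuous_id.mul continuous_const)
    simpa using (this.tendsto 1).mono_left nhdsWithin_le_nhds
  exact le_of_tendsto_of_tendsto (hlim (g s)) ((hlim (g 0)).add_const _)
    (eventually_of_mem (Ioo_mem_nhdsLT one_pos) contracted)

/-- For a base point `b ∈ 𝒞` and a smooth curve `φ : [0,1] → 𝒞`, the
geodesic distance `d(u₀,u₁) = arccos(4 ∫ e^{(u₀+u₁)/2} dμ)` satisfies, for every `s ∈ [0,1]`,
`d(b, φ(s)) ≤ d(b, φ(0)) + length of φ between φ(0) and φ(s)`. -/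
theorem calabi_distance_triangle_along_curve
    {M : Type*} [TopologicalSpace M] [CompactSpace M] [Nonempty M]
    [MeasurableSpace M] [BorelSpace M]
    (μ : Measure M) [IsFiniteMeasure μ] [μ.IsOpenPosMeasure]
    (hVol : (μ Set.univ).toReal = 1 / 4)
    (b : M → ℝ) (hbc : Continuous b) (hbC : ∫ p, Real.exp (b p) ∂μ = 1 / 4)
    (φ : ℝ → M → ℝ) (hφ : SmoothFamily φ)
    (hφC : ∀ τ ∈ Set.Icc (0 : ℝ) 1, ∫ p, Real.exp (φ τ p) ∂μ = 1 / 4) :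
    ∀ s ∈ Set.Icc (0 : ℝ) 1,
      Real.arccos (4 * ∫ p, Real.exp ((b p + φ s p) / 2) ∂μ)
        ≤ Real.arccos (4 * ∫ p, Real.exp ((b p + φ 0 p) / 2) ∂μ)
          + ∫ τ in (0 : ℝ)..s,
              Real.sqrt (∫ p, (deriv (fun r => φ r p) τ) ^ 2 * Real.exp (φ τ p) ∂μ) := by
  have hc := hφ.continuous
  have hc' := hφ.continuous_deriv
  have hφτ : ∀ τ, Continuous (φ τ) := fun τ => hc.comp (Continuous.prodMk_right τ)
  have hb2 : Continuous fun q : ℝ × M => b q.2 := hbc.comp continuous_snd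
  have hL : Continuous fun τ => √(∫ p, (deriv (fun r => φ r p) τ) ^ 2 * exp (φ τ p) ∂μ) :=
    (continuous_integral_of_jointly_continuous μ (by fun_prop)).sqrt
  have hg : ∀ τ, HasDerivAt (fun r => 4 * ∫ p, exp ((b p + φ r p) / 2) ∂μ)
      (2 * ∫ p, deriv (fun r => φ r p) τ * exp ((b p + φ τ p) / 2) ∂μ) τ := fun τ => by
    have h := (hasDerivAt_integral_of_jointly_continuous μ
      (F := fun r p => exp ((b p + φ r p) / 2))
      (F' := fun r p => exp ((b p + φ r p) / 2) * (deriv (fun r => φ r p) r / 2))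
      (by fun_prop) (by fun_prop)
      (fun τ p => (((hφ.hasDerivAt τ p).const_add (b p)).div_const 2).exp) τ).const_mul 4
    refine h.congr_deriv ?_
    rw [← integral_const_mul, ← integral_const_mul]
    exact integral_congr_ae (ae_of_all _ fun p => by ring)
  have horth : ∀ τ ∈ Set.Ioo (0 : ℝ) 1,
      ∫ p, deriv (fun r => φ r p) τ * exp (φ τ p) ∂μ = 0 := fun τ hτ => by
    have h := hasDerivAt_integral_of_jointly_continuous μ (F := fun r p => exp (φ r p))
      (F' := fun r p => exp (φ r p) * deriv (fun r => φ r p) r)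
      (by fun_prop) (by fun_prop) (fun τ p => (hφ.hasDerivAt τ p).exp) τ
    have hconst : (fun r => ∫ p, exp (φ r p) ∂μ) =ᶠ[𝓝 τ] fun _ => 1 / 4 :=
      eventually_of_mem (Icc_mem_nhds hτ.1 hτ.2) hφC
    simp_rw [mul_comm (deriv _ _)]
    exact h.unique ((hasDerivAt_const τ (1 / 4 : ℝ)).congr_of_eventuallyEq hconst)
  exact fun s hs => arccos_le_arccos_add_integral hL (fun _ => sqrt_nonneg _) hg
    (fun τ hτ => abs_affinity_le_one μ hbc (hφτ τ) hbC (hφC τ hτ))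
    (fun τ hτ => abs_integral_mul_exp_half_le μ hbc (hφτ τ)
      (hc'.comp (Continuous.prodMk_right τ)) hbC (hφC τ ⟨hτ.1.le, hτ.2.le⟩) (horth τ hτ)) hs
end
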